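/- Elfving's theorem (equation (3)): Let X be a compact subset of R^k, let c in R^k be nonzero with c in span(X), and let E = conv(X union -X) be the Elfving set, where -X is the reflection of X through the origin. Let z be a point of E lying on the ray R(c) = {gamma * c : gamma in R} that is farthest from the origin, i.e., ||z|| >= ||w|| for every w in E with w in R(c), and write z = sum_{i=1}^n p_i eps_i x_i with x_i in X, eps_i in {-1, +1}, p_i >= 0, sum_i p_i = 1. Then z is nonzero, c is estimable under the design xi = {(x_i, p_i)}, Psi(xi) = ||c||^2 / ||z||^2, and xi is c-optimal: Psi(xi) <= Psi(eta) for every finitely supported design eta on X under which c is estimable. -/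

import Mathlib

open Matrix BigOperators

/-- The information matrix of a design with points `x i` and weights `p i`. -/
noncomputable def infoMat {k n : ℕ} (x : Fin n → Fin k → ℝ) (p : Fin n → ℝ) :
    Matrix (Fin k) (Fin k) ℝ :=
  ∑ i, p i • vecMulVec (x i) (x i)

lemma infoMat_mulVec {k n : ℕ} (x : Fin n → Fin k → ℝ) (p : Fin n → ℝ) (d : Fin k → ℝ) :
    infoMat x p *ᵥ d = ∑ i, (p i * (x i ⬝ᵥ d)) • x i := by
  simp only [infoMat, Matrix.sum_mulVec, Matrix.smul_mulVec, vecMulVec_mulVec]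
  refine Finset.sum_congr rfl fun i _ => ?_
  rw [op_smul_eq_smul, smul_smul]

lemma infoMat_mulVec_dotProduct_self {k n : ℕ} (x : Fin n → Fin k → ℝ) (p : Fin n → ℝ)
    (d : Fin k → ℝ) : (infoMat x p *ᵥ d) ⬝ᵥ d = ∑ i, p i * (x i ⬝ᵥ d) ^ 2 := by
  rw [infoMat_mulVec, sum_dotProduct]
  refine Finset.sum_congr rfl fun i _ => ?_
  rw [smul_dotProduct, smul_eq_mul]
  ring

/-- Weighted Cauchy-Schwarz inequality. -/
lemma sq_sum_weight_mul_le {ι : Type*} (s : Finset ι) (p f : ι → ℝ) (hp : ∀ i ∈ s, 0 ≤ p i)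
    (hsum : ∑ i ∈ s, p i = 1) : (∑ i ∈ s, p i * f i) ^ 2 ≤ ∑ i ∈ s, p i * f i ^ 2 := by
  simpa only [smul_eq_mul] using
    (even_two.convexOn_pow (𝕜 := ℝ)).map_sum_le hp hsum fun i _ => Set.mem_univ (f i)

/-- The range of an information matrix contains all combinations `∑ p_i u_i x_i`. -/
lemma exists_infoMat_mulVec_eq {k n : ℕ} (x : Fin n → Fin k → ℝ) (p u : Fin n → ℝ)
    (hp : ∀ i, 0 ≤ p i) : ∃ d, infoMat x p *ᵥ d = ∑ i, (p i * u i) • x i := by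
  set A : Matrix (Fin n) (Fin k) ℝ := Matrix.of fun i j => √(p i) * x i j with hA
  have hM : infoMat x p = Aᵀ * A := by
    ext a b
    simp only [infoMat, Matrix.sum_apply, Matrix.smul_apply, vecMulVec_apply, smul_eq_mul,
      Matrix.mul_apply, Matrix.transpose_apply, hA, Matrix.of_apply]
    refine Finset.sum_congr rfl fun i _ => ?_
    linear_combination (-(x i a * x i b)) * Real.mul_self_sqrt (hp i)
  have hv : Aᵀ *ᵥ (fun i => √(p i) * u i) = ∑ i, (p i * u i) • x i := by
    ext a
    simp only [Matrix.mulVec, dotProduct, Matrix.transpose_apply, hA, Matrix.of_apply,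
      Finset.sum_apply, Pi.smul_apply, smul_eq_mul]
    refine Finset.sum_congr rfl fun i _ => ?_
    linear_combination (x i a * u i) * Real.mul_self_sqrt (hp i)
  have hrange : LinearMap.range (Aᵀ * A).mulVecLin = LinearMap.range Aᵀ.mulVecLin := by
    refine Submodule.eq_of_le_of_finrank_eq ?_ ?_
    · rw [Matrix.mulVecLin_mul]
      exact LinearMap.range_comp_le_range _ _
    · exact (Matrix.rank_transpose_mul_self A).trans (Matrix.rank_transpose A).symm
  have hmem : ∑ i, (p i * u i) • x i ∈ LinearMap.range (Aᵀ * A).mulVecLin := by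
    rw [hrange, ← hv]
    exact ⟨_, rfl⟩
  rw [hM]
  exact hmem

lemma inv_sum_abs_smul_mem_convexHull {E ι : Type*} [AddCommGroup E] [Module ℝ E] {X : Set E}
    (s : Finset ι) (a : ι → ℝ) (y : ι → E) (hy : ∀ i ∈ s, y i ∈ X) (hs : 0 < ∑ i ∈ s, |a i|) :
    (∑ i ∈ s, |a i|)⁻¹ • ∑ i ∈ s, a i • y i ∈ convexHull ℝ (X ∪ -X) := by
  have hmem : ∑ i ∈ s, ((∑ i ∈ s, |a i|)⁻¹ * |a i|) • (if 0 ≤ a i then y i else -y i) ∈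
      convexHull ℝ (X ∪ -X) := by
    refine (convex_convexHull ℝ _).sum_mem (fun i _ => by positivity) ?_ fun i hi => ?_
    · rw [← Finset.mul_sum, inv_mul_cancel₀ hs.ne']
    · apply subset_convexHull
      split_ifs
      · exact Or.inl (hy i hi)
      · exact Or.inr (by simpa using hy i hi)
  convert hmem using 1
  rw [Finset.smul_sum]
  refine Finset.sum_congr rfl fun i _ => ?_
  rw [mul_smul]
  congr 1
  split_ifs with h
  · rw [abs_of_nonneg h]
  · rw [abs_of_neg (not_le.mp h), neg_smul_neg]

/-- If `z` is farthest from the origin among the points of the Elfving set on the line `ℝ c`, then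
any representation of `c` as a combination of points of `X` has a large coefficient sum. -/
lemma dotProduct_self_le_sq_sum_abs_mul {k : ℕ} {ι : Type*} {X : Set (Fin k → ℝ)}
    {c z : Fin k → ℝ} (hc : c ≠ 0)
    (hzmax : ∀ w ∈ convexHull ℝ (X ∪ -X), (∃ γ : ℝ, w = γ • c) → w ⬝ᵥ w ≤ z ⬝ᵥ z)
    (s : Finset ι) (a : ι → ℝ) (y : ι → Fin k → ℝ) (hy : ∀ i ∈ s, y i ∈ X)
    (hrep : ∑ i ∈ s, a i • y i = c) :
    c ⬝ᵥ c ≤ (∑ i ∈ s, |a i|) ^ 2 * (z ⬝ᵥ z) := by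
  have hs : 0 < ∑ i ∈ s, |a i| := by
    refine (Finset.sum_nonneg fun i _ => abs_nonneg (a i)).lt_of_ne' fun h0 => hc ?_
    rw [← hrep]
    refine Finset.sum_eq_zero fun i hi => ?_
    rw [abs_eq_zero.mp ((Finset.sum_eq_zero_iff_of_nonneg fun i _ => abs_nonneg (a i)).mp h0 i hi),
      zero_smul]
  have h := hzmax _ (inv_sum_abs_smul_mem_convexHull s a y hy hs) ⟨_, by rw [hrep]⟩
  rw [hrep, smul_dotProduct, dotProduct_smul, smul_eq_mul, smul_eq_mul, ← mul_assoc, ← mul_inv,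
    ← sq, inv_mul_le_iff₀ (by positivity)] at h
  exact h

/-- Elfving's theorem, equation (3): let `X ⊆ ℝᵏ` be compact, `c ≠ 0` with
`c ∈ span X`, and `E = conv(X ∪ -X)` the Elfving set.  If `z ∈ E` lies on the ray
`R(c) = {γ c}`, is farthest from the origin among points of `E` on `R(c)`, and is written
as `z = ∑ i p_i ε_i x_i` with `x_i ∈ X`, `ε_i ∈ {-1,+1}`, `p_i ≥ 0`, `∑ p_i = 1`, then
`z ≠ 0`, `c` is estimable under `ξ = {(x_i, p_i)}`, `Ψ(ξ) = ‖c‖²/‖z‖²`, and `ξ` is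
`c`-optimal among all finitely supported designs on `X` under which `c` is estimable.
Here `Ψ(ξ) = cᵀ d` for any `d` with `M(ξ) d = c`, and `‖v‖² = v ⬝ᵥ v`. -/
theorem elfving_theorem {k n : ℕ} (hk : 1 ≤ k)
    (X : Set (Fin k → ℝ)) (hX : IsCompact X)
    (c : Fin k → ℝ) (hc : c ≠ 0) (hcspan : c ∈ Submodule.span ℝ X)
    (z : Fin k → ℝ)
    (hzE : z ∈ convexHull ℝ (X ∪ -X))
    (hzray : ∃ γ : ℝ, z = γ • c)
    (hzmax : ∀ w ∈ convexHull ℝ (X ∪ -X), (∃ γ : ℝ, w = γ • c) → w ⬝ᵥ w ≤ z ⬝ᵥ z)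
    (x : Fin n → Fin k → ℝ) (hxX : ∀ i, x i ∈ X)
    (ε : Fin n → ℝ) (hε : ∀ i, ε i = 1 ∨ ε i = -1)
    (p : Fin n → ℝ) (hp : ∀ i, 0 ≤ p i) (hpsum : ∑ i, p i = 1)
    (hzrep : z = ∑ i, (p i * ε i) • x i) :
    z ≠ 0 ∧
    (∃ d : Fin k → ℝ, (infoMat x p) *ᵥ d = c) ∧
    (∀ d : Fin k → ℝ, (infoMat x p) *ᵥ d = c → c ⬝ᵥ d = (c ⬝ᵥ c) / (z ⬝ᵥ z)) ∧
    (∀ (m : ℕ) (y : Fin m → Fin k → ℝ) (q : Fin m → ℝ),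
      (∀ i, y i ∈ X) → (∀ i, 0 ≤ q i) → ∑ i, q i = 1 →
      ∀ e : Fin k → ℝ, (infoMat y q) *ᵥ e = c →
        ∀ d : Fin k → ℝ, (infoMat x p) *ᵥ d = c → c ⬝ᵥ d ≤ c ⬝ᵥ e) := by
  have hcc : 0 < c ⬝ᵥ c := by
    have := Matrix.dotProduct_star_self_pos_iff.mpr hc
    rwa [star_trivial] at this
  have hz : z ≠ 0 := by
    rintro rfl
    obtain ⟨m, a, g, hg⟩ := Submodule.mem_span_set'.mp hcspan
    have h := dotProduct_self_le_sq_sum_abs_mul hc hzmax Finset.univ a (fun i => (g i : Fin k → ℝ))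
      (fun i _ => (g i).2) hg
    rw [dotProduct_zero, mul_zero] at h
    exact hcc.not_ge h
  have hzz : 0 < z ⬝ᵥ z := by
    have := Matrix.dotProduct_star_self_pos_iff.mpr hz
    rwa [star_trivial] at this
  obtain ⟨γ, hγ⟩ := hzray
  have hγ0 : γ ≠ 0 := by
    rintro rfl
    exact hz (by rw [hγ, zero_smul])
  have lower : ∀ (m : ℕ) (y : Fin m → Fin k → ℝ) (q : Fin m → ℝ),
      (∀ i, y i ∈ X) → (∀ i, 0 ≤ q i) → ∑ i, q i = 1 →
      ∀ e : Fin k → ℝ, (infoMat y q) *ᵥ e = c → (c ⬝ᵥ c) / (z ⬝ᵥ z) ≤ c ⬝ᵥ e := by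
    intro m y q hy hq hqsum e he
    have h := dotProduct_self_le_sq_sum_abs_mul hc hzmax Finset.univ
      (fun i => q i * (y i ⬝ᵥ e)) y (fun i _ => hy i) (by rw [← infoMat_mulVec, he])
    have hcs := sq_sum_weight_mul_le Finset.univ q (fun i => |y i ⬝ᵥ e|) (fun i _ => hq i) hqsum
    simp only [sq_abs, ← infoMat_mulVec_dotProduct_self, he] at hcs
    simp only [abs_mul, abs_of_nonneg (hq _)] at h
    rw [div_le_iff₀ hzz]
    exact h.trans (mul_le_mul_of_nonneg_right hcs hzz.le)
  have upper : ∀ d : Fin k → ℝ, (infoMat x p) *ᵥ d = c → c ⬝ᵥ d ≤ (c ⬝ᵥ c) / (z ⬝ᵥ z) := by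
    intro d hd
    have hcs := sq_sum_weight_mul_le Finset.univ p (fun i => ε i * (x i ⬝ᵥ d)) (fun i _ => hp i)
      hpsum
    have hε2 : ∀ i, ε i ^ 2 = 1 := fun i => by
      rcases hε i with h | h <;> simp [h]
    have hzd : ∑ i, p i * (ε i * (x i ⬝ᵥ d)) = γ * (c ⬝ᵥ d) := by
      rw [← smul_eq_mul γ, ← smul_dotProduct, ← hγ, hzrep, sum_dotProduct]
      simp only [smul_dotProduct, smul_eq_mul, mul_assoc]
    simp only [mul_pow, hε2, one_mul, ← infoMat_mulVec_dotProduct_self, hd, hzd] at hcs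
    have hpos : 0 < c ⬝ᵥ d :=
      (div_pos hcc hzz).trans_le (lower n x p hxX hp hpsum d hd)
    have hle : γ ^ 2 * (c ⬝ᵥ d) ≤ 1 := by nlinarith
    have hzz' : z ⬝ᵥ z = γ ^ 2 * (c ⬝ᵥ c) := by
      rw [hγ, smul_dotProduct, dotProduct_smul, smul_eq_mul, smul_eq_mul]
      ring
    rw [le_div_iff₀ hzz, hzz']
    nlinarith
  refine ⟨hz, ?_, fun d hd => (upper d hd).antisymm (lower n x p hxX hp hpsum d hd),
    fun m y q hy hq hqsum e he d hd => (upper d hd).trans (lower m y q hy hq hqsum e he)⟩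
  obtain ⟨d, hd⟩ := exists_infoMat_mulVec_eq x p ε hp
  refine ⟨γ⁻¹ • d, ?_⟩
  rw [Matrix.mulVec_smul, hd, ← hzrep, hγ, inv_smul_smul₀ hγ0]
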